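/- Let f : ℝ → ℂ be continuous, integrable, and a positive-definite function, i.e., for every n, every t : Fin n → ℝ, and every v : Fin n → ℂ, the sum ∑_{i,j} conj(v i) · (v j) · f(t j − t i) is a nonnegative real number. Then for every ω ∈ ℝ, the Fourier integral ∫_{-∞}^{∞} e^{iωt} f(t) dt is a nonnegative real number. -/

import Mathlib

open MeasureTheory Complex

open ProbabilityTheory Filter Topology
open scoped NNReal ComplexOrder

/-- Two distinct coordinates of a power of a probability measure have the product law. -/
theorem measurePreserving_pi_eval_pair {ι α : Type*} [Fintype ι] [MeasurableSpace α]
    (μ : Measure α) [IsProbabilityMeasure μ] {i j : ι} (hij : i ≠ j) :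
    MeasurePreserving (fun x : ι → α => (x i, x j)) (Measure.pi fun _ => μ) (μ.prod μ) := by
  refine ⟨by fun_prop, ?_⟩
  have h : iIndepFun (fun (i : ι) (x : ι → α) => x i) (Measure.pi fun _ => μ) :=
    iIndepFun_pi (X := fun _ => id) fun _ => aemeasurable_id
  rw [(indepFun_iff_map_prod_eq_prod_map_map (measurable_pi_apply i).aemeasurable
    (measurable_pi_apply j).aemeasurable).1 (h.indepFun hij),
    (measurePreserving_eval _ i).map_eq, (measurePreserving_eval _ j).map_eq]

/-- A kernel whose sums over finite families of points are nonnegative has nonnegative integral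
against the square of any probability measure. -/
theorem integral_prod_self_nonneg_of_sum_nonneg {α : Type*} [MeasurableSpace α]
    (μ : Measure α) [IsProbabilityMeasure μ] {K : α → α → ℂ} {c : ℂ} (hdiag : ∀ x, K x x = c)
    (hK : ∀ (n : ℕ) (x : Fin n → α), 0 ≤ ∑ i, ∑ j, K (x i) (x j))
    (hint : Integrable (fun p : α × α => K p.1 p.2) (μ.prod μ)) :
    0 ≤ ∫ p, K p.1 p.2 ∂(μ.prod μ) := by
  set I := ∫ p, K p.1 p.2 ∂(μ.prod μ) with hI
  have key (n : ℕ) : 0 ≤ ((n + 1 : ℕ) : ℂ) * (c + n * I) := by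
    let P : Measure (Fin (n + 1) → α) := Measure.pi fun _ => μ
    have hmp {i j : Fin (n + 1)} (hij : i ≠ j) := measurePreserving_pi_eval_pair μ hij
    have hKint (i j : Fin (n + 1)) : Integrable (fun x => K (x i) (x j)) P := by
      by_cases hij : i = j
      · subst hij
        simp only [hdiag]
        exact integrable_const c
      · exact (hmp hij).integrable_comp_of_integrable hint
    have hKval (i j : Fin (n + 1)) :
        ∫ x, K (x i) (x j) ∂P = if i = j then c else I := by
      split_ifs with hij
      · subst hij
        simp [hdiag]
      · rw [hI, ← (hmp hij).map_eq, integral_map (hmp hij).aemeasurable]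
        rw [(hmp hij).map_eq]
        exact hint.aestronglyMeasurable
    have h0 : 0 ≤ ∫ x, ∑ i, ∑ j, K (x i) (x j) ∂P := integral_nonneg (hK (n + 1))
    rw [integral_finsetSum _ fun i _ => integrable_finsetSum _ fun j _ => hKint i j] at h0
    simp_rw [integral_finsetSum _ fun j _ => hKint _ j, hKval] at h0
    have hrow (i : Fin (n + 1)) : ∑ j, (if i = j then c else I) = c + n * I := by
      rw [← Finset.add_sum_erase _ _ (Finset.mem_univ i), if_pos rfl,
        Finset.sum_congr rfl fun j hj => if_neg (Finset.ne_of_mem_erase hj).symm]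
      simp
    simpa [hrow, mul_add] using h0
  have hlim : Tendsto (fun n : ℕ => c * (n : ℂ)⁻¹ + I) atTop (𝓝 (c * 0 + I)) :=
    (tendsto_inv_atTop_nhds_zero_nat (𝕜 := ℂ)).const_mul c |>.add_const I
  rw [mul_zero, zero_add] at hlim
  refine ge_of_tendsto hlim ?_
  filter_upwards [eventually_gt_atTop 0] with n hn
  have hn' : (n : ℂ) ≠ 0 := by exact_mod_cast hn.ne'
  have hn1 : ((n + 1 : ℕ) : ℂ) ≠ 0 := by exact_mod_cast n.succ_ne_zero
  have hpos : (0 : ℂ) ≤ ((((n + 1 : ℕ) : ℝ)⁻¹ * (n : ℝ)⁻¹ : ℝ) : ℂ) := by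
    rw [Complex.zero_le_real]; positivity
  convert mul_nonneg hpos (key n) using 1
  push_cast at hn1 ⊢
  field_simp

/-- The difference of two independent centred Gaussians of variance `v` is Gaussian of variance
`v + v`. -/
theorem gaussianReal_prod_map_sub (v : ℝ≥0) :
    ((gaussianReal 0 v).prod (gaussianReal 0 v)).map (fun p : ℝ × ℝ => p.2 - p.1) =
      gaussianReal 0 (v + v) := by
  have h := gaussianReal_add_gaussianReal_of_indepFun
    (P := (gaussianReal 0 v).prod (gaussianReal 0 v)) (X := fun p => p.2) (Y := fun p => -p.1)
    (m₁ := 0) (m₂ := 0) (v₁ := v) (v₂ := v)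
    (indepFun_prod (X := fun x : ℝ => -x) (Y := fun x : ℝ => x) (by fun_prop) (by fun_prop)).symm
    (by rw [Measure.map_snd_prod]; simp)
    (by
      change Measure.map ((fun x : ℝ => -x) ∘ Prod.fst) _ = _
      rw [← Measure.map_map (g := fun x : ℝ => -x) (f := Prod.fst) (by fun_prop) (by fun_prop),
        Measure.map_fst_prod]
      simp [gaussianReal_map_neg])
  rw [add_zero] at h
  rw [← h]
  rfl

/-- A Lebesgue-integrable function is integrable against nondegenerate Gaussian measures. -/
theorem integrable_gaussianReal_of_integrable {g : ℝ → ℂ} (hint : Integrable g)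
    (m : ℝ) {v : ℝ≥0} (hv : v ≠ 0) : Integrable g (gaussianReal m v) := by
  rw [gaussianReal_of_var_ne_zero _ hv,
    integrable_withDensity_iff_integrable_smul' (by fun_prop)
      (ae_of_all _ fun _ => gaussianPDF_lt_top)]
  simp_rw [toReal_gaussianPDF]
  refine Integrable.bdd_smul (φ := gaussianPDFReal m v) hint (√(2 * Real.pi * v))⁻¹
    (measurable_gaussianPDFReal m v).aestronglyMeasurable (ae_of_all _ fun x => ?_)
  rw [Real.norm_of_nonneg (gaussianPDFReal_nonneg _ _ _), gaussianPDFReal]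
  refine mul_le_of_le_one_right (by positivity) (Real.exp_le_one_iff.2 ?_)
  rw [neg_div]
  exact neg_nonpos.2 (by positivity)

/-- Gaussian regularisations of an integral converge to it. -/
theorem tendsto_integral_exp_neg_sq_div_smul {g : ℝ → ℂ} (hint : Integrable g) :
    Tendsto (fun n : ℕ => ∫ x, Real.exp (-x ^ 2 / (n + 1)) • g x) atTop (𝓝 (∫ x, g x)) := by
  refine tendsto_integral_of_dominated_convergence (fun x => ‖g x‖) (fun n => ?_) hint.norm
    (fun n => ae_of_all _ fun x => ?_) (ae_of_all _ fun x => ?_)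
  · have hexp : Continuous fun x : ℝ => Real.exp (-x ^ 2 / (n + 1)) := by fun_prop
    exact hexp.aestronglyMeasurable.smul hint.aestronglyMeasurable
  · rw [norm_smul, Real.norm_of_nonneg (Real.exp_pos _).le]
    refine mul_le_of_le_one_left (norm_nonneg _) (Real.exp_le_one_iff.2 ?_)
    rw [neg_div]
    exact neg_nonpos.2 (by positivity)
  · have h : Tendsto (fun n : ℕ => -x ^ 2 * (1 / ((n : ℝ) + 1))) atTop (𝓝 (-x ^ 2 * 0)) :=
      tendsto_one_div_add_atTop_nhds_zero_nat.const_mul _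
    have h' := ((Real.continuous_exp.tendsto _).comp h).smul_const (g x)
    simpa [Function.comp_def, div_eq_mul_inv] using h'

/-- An integrable function whose difference kernel has nonnegative finite sums has nonnegative
integral. -/
theorem integral_nonneg_of_sum_sub_nonneg {g : ℝ → ℂ} (hint : Integrable g)
    (hg : ∀ (n : ℕ) (t : Fin n → ℝ), 0 ≤ ∑ i, ∑ j, g (t j - t i)) :
    0 ≤ ∫ x, g x := by
  refine ge_of_tendsto' (tendsto_integral_exp_neg_sq_div_smul hint) fun n => ?_
  let v : ℝ≥0 := (n + 1) / 4
  have hv : v + v ≠ 0 := by positivity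
  have hv' : 2 * ((v + v : ℝ≥0) : ℝ) = n + 1 := by
    simp only [v]; push_cast; ring
  have hmap := gaussianReal_prod_map_sub v
  have hgint := integrable_gaussianReal_of_integrable hint 0 hv
  have hpos : 0 ≤ ∫ x, g x ∂(gaussianReal 0 (v + v)) := by
    rw [← hmap] at hgint ⊢
    rw [integral_map (by fun_prop) hgint.aestronglyMeasurable]
    exact integral_prod_self_nonneg_of_sum_nonneg (gaussianReal 0 v)
      (K := fun x y => g (y - x)) (c := g 0) (by simp) hg
      (hgint.comp_aemeasurable (by fun_prop))
  rw [integral_gaussianReal_eq_integral_smul hv] at hpos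
  simp_rw [gaussianPDFReal, sub_zero, hv', mul_smul, integral_smul] at hpos
  have hc : 0 < √(2 * Real.pi * ((v + v : ℝ≥0) : ℝ)) := by positivity
  have h := smul_nonneg hc.le hpos
  rwa [smul_inv_smul₀ hc.ne'] at h

/-- Scalar Bochner-type positivity of the power spectrum: the Fourier integral
`∫ e^{iωt} f(t) dt` of a continuous, integrable, positive-definite function `f` is a
nonnegative real number for every frequency `ω`. -/
theorem fourier_integral_of_posdef_nonneg
    (f : ℝ → ℂ) (hcont : Continuous f) (hint : Integrable f)
    (hposdef : ∀ (n : ℕ) (t : Fin n → ℝ) (v : Fin n → ℂ),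
      ∃ r : ℝ, 0 ≤ r ∧
        (∑ i, ∑ j, (starRingEnd ℂ (v i)) * (v j) * f (t j - t i)) = (r : ℂ)) :
    ∀ ω : ℝ,
      ∃ r : ℝ, 0 ≤ r ∧
        (∫ t : ℝ, Complex.exp (Complex.I * (ω : ℂ) * (t : ℂ)) * f t) = (r : ℂ) := by
  intro ω
  let e : ℝ → ℂ := fun t => Complex.exp (Complex.I * (ω : ℂ) * (t : ℂ))
  have he_norm (t : ℝ) : ‖e t‖ = 1 := by
    simpa [e, mul_comm, mul_assoc, mul_left_comm] using Complex.norm_exp_ofReal_mul_I (ω * t)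
  have he_sub (s t : ℝ) : e (t - s) = starRingEnd ℂ (e s) * e t := by
    simp only [e, ← Complex.exp_conj, ← Complex.exp_add, map_mul, Complex.conj_I,
      Complex.conj_ofReal]
    congr 1
    push_cast
    ring
  have hgint : Integrable fun t => e t * f t :=
    hint.bdd_mul (c := 1) (Continuous.aestronglyMeasurable (by fun_prop))
      (ae_of_all _ fun t => (he_norm t).le)
  have hpos : 0 ≤ ∫ t, e t * f t := by
    refine integral_nonneg_of_sum_sub_nonneg hgint fun n t => ?_
    obtain ⟨r, hr, h⟩ := hposdef n t fun i => e (t i)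
    simp_rw [he_sub, h]
    exact Complex.zero_le_real.2 hr
  obtain ⟨hre, him⟩ := Complex.nonneg_iff.1 hpos
  exact ⟨_, hre, Complex.ext rfl (by simpa using him.symm)⟩
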